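/- Fix p ∈ (0,1), q := 1 − p, δ ∈ (0,1), and fix a twice continuously differentiable function g : ℝ → ℝ on [−1,1] (independent of N), and points α_1 < ⋯ < α_K in (−1,1). For each N ≥ 3, let the decoder points be the second-kind Chebyshev points β_n := cos((n−1)π/(N−1)) for n = 1,…,N, let 0 < λ ≤ N^{−6}, let B_1,…,B_N be i.i.d. Bernoulli(p) straggler indicators with F := {n : B_n = 0}, and on F ≠ ∅ let u_dec be the smoothing-spline minimizer for nodes {β_v : v ∈ F}, data values g(β_v), and parameter λ. Then there exist a constant C > 0 and n_0 ∈ ℕ such that for all N > n_0, with probability at least 1 − δ, F ≠ ∅ and (1/K)·Σ_{k=1}^K (u_dec(α_k) − g(α_k))² ≤ C · (log_{1/p} N)³ / N³. -/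

import Mathlib

open MeasureTheory

/-- The Bernoulli measure on `Bool` giving probability `p` to `true` (straggler). -/
noncomputable def bernoulliMeasure (p : ℝ) : Measure Bool :=
  ENNReal.ofReal p • Measure.dirac true + ENNReal.ofReal (1 - p) • Measure.dirac false

/-- The law of `N` i.i.d. Bernoulli(p) straggler indicators. -/
noncomputable def stragglerMeasure (p : ℝ) (N : ℕ) : Measure (Fin N → Bool) :=
  Measure.pi fun _ => bernoulliMeasure p

/-- The set of non-straggler servers: those `n` with `B_n = 0` (i.e. `ω n = false`). -/
def nonStragglers {N : ℕ} (ω : Fin N → Bool) : Finset (Fin N) :=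
  Finset.univ.filter fun n => ω n = false

/-- The second-kind Chebyshev points `β_n = cos((n−1)π/(N−1))`, `n = 1,…,N`
(indexed here by `Fin N`, zero-based). -/
noncomputable def chebNodes (N : ℕ) : Fin N → ℝ := fun n =>
  Real.cos ((n : ℕ) * Real.pi / ((N : ℝ) - 1))

/-- The smoothing-spline objective
`J(u) := (1/|F|)·Σ_{v∈F} (u(β_v) − y_v)² + λ·∫_{−1}^{1} (u''(t))² dt`. -/
noncomputable def splineLoss {N : ℕ} (F : Finset (Fin N)) (β y : Fin N → ℝ) (lam : ℝ)
    (u : ℝ → ℝ) : ℝ :=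
  (1 / (F.card : ℝ)) * ∑ v ∈ F, (u (β v) - y v) ^ 2 +
    lam * ∫ t in Set.Icc (-1 : ℝ) 1, (iteratedDerivWithin 2 u (Set.Icc (-1 : ℝ) 1) t) ^ 2

/-- Admissible competitors: twice continuously differentiable on `[−1,1]`
with square-integrable second derivative. -/
def SplineAdmissible (u : ℝ → ℝ) : Prop :=
  ContDiffOn ℝ 2 u (Set.Icc (-1 : ℝ) 1) ∧
    MeasureTheory.IntegrableOn
      (fun t => (iteratedDerivWithin 2 u (Set.Icc (-1 : ℝ) 1) t) ^ 2) (Set.Icc (-1 : ℝ) 1)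

/-- `u` is a smoothing-spline minimizer for nodes `{β_v : v ∈ F}`, data `y_v`, parameter `λ`. -/
def IsSmoothingSpline {N : ℕ} (F : Finset (Fin N)) (β y : Fin N → ℝ) (lam : ℝ)
    (u : ℝ → ℝ) : Prop :=
  SplineAdmissible u ∧ ∀ w, SplineAdmissible w → splineLoss F β y lam u ≤ splineLoss F β y lam w

lemma sq_intervalIntegral_le {f : ℝ → ℝ} {a b : ℝ} (hab : a ≤ b)
    (hf : ContinuousOn f (Set.Icc a b)) :
    (∫ t in a..b, f t) ^ 2 ≤ (b - a) * ∫ t in a..b, f t ^ 2 := by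
  rcases hab.eq_or_lt with rfl | hlt
  · simp
  have hfi : IntervalIntegrable f volume a b :=
    ContinuousOn.intervalIntegrable_of_Icc hab hf
  have hf2 : IntervalIntegrable (fun t => f t ^ 2) volume a b :=
    ContinuousOn.intervalIntegrable_of_Icc hab (hf.pow 2)
  set c : ℝ := (∫ t in a..b, f t) / (b - a) with hc
  have hnonneg : 0 ≤ ∫ t in a..b, (f t - c) ^ 2 :=
    intervalIntegral.integral_nonneg hab fun _ _ => sq_nonneg _
  have hexp : ∫ t in a..b, (f t - c) ^ 2 =
      (∫ t in a..b, f t ^ 2) - 2 * c * (∫ t in a..b, f t) + (b - a) * c ^ 2 := by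
    have : (fun t => (f t - c) ^ 2) = fun t => (f t ^ 2 - 2 * c * f t) + c ^ 2 := by
      funext t; ring
    rw [this, intervalIntegral.integral_add (hf2.sub (hfi.const_mul _)) (by simp),
      intervalIntegral.integral_sub hf2 (hfi.const_mul _),
      intervalIntegral.integral_const_mul, intervalIntegral.integral_const, smul_eq_mul]
  have hpos : 0 < b - a := sub_pos.2 hlt
  have hI : ∫ t in a..b, f t = c * (b - a) := by rw [hc]; field_simp
  rw [hexp, hI] at hnonneg
  rw [hI]
  nlinarith [mul_nonneg hpos.le hnonneg]

lemma sq_derivWithin_sub_le {u : ℝ → ℝ} {l r a b : ℝ}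
    (hu : ContDiffOn ℝ 2 u (Set.Icc l r)) (hla : l < a) (hab : a ≤ b) (hbr : b < r) :
    (derivWithin u (Set.Icc l r) b - derivWithin u (Set.Icc l r) a) ^ 2 ≤
      (b - a) * ∫ t in Set.Icc l r, (iteratedDerivWithin 2 u (Set.Icc l r) t) ^ 2 := by
  have huniq : UniqueDiffOn ℝ (Set.Icc l r) := uniqueDiffOn_Icc (by linarith)
  have hsub : Set.Icc a b ⊆ Set.Icc l r := Set.Icc_subset_Icc hla.le hbr.le
  have hcont : ContinuousOn (iteratedDerivWithin 2 u (Set.Icc l r)) (Set.Icc l r) :=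
    hu.continuousOn_iteratedDerivWithin le_rfl huniq
  have hd : ContDiffOn ℝ 1 (derivWithin u (Set.Icc l r)) (Set.Icc l r) :=
    hu.derivWithin huniq (by norm_num)
  have hderiv : ∀ t ∈ Set.uIcc a b, HasDerivAt (derivWithin u (Set.Icc l r))
      (iteratedDerivWithin 2 u (Set.Icc l r) t) t := by
    intro t ht
    rw [Set.uIcc_of_le hab] at ht
    have h1 := ((hd.differentiableOn (by norm_num)) t (hsub ht)).hasDerivWithinAt.hasDerivAt
      (Icc_mem_nhds (hla.trans_le ht.1) (ht.2.trans_lt hbr))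
    have h2 : iteratedDerivWithin 2 u (Set.Icc l r) t =
        derivWithin (derivWithin u (Set.Icc l r)) (Set.Icc l r) t := by
      rw [show (2 : ℕ) = 1 + 1 from rfl, iteratedDerivWithin_succ, iteratedDerivWithin_one]
    rwa [h2]
  rw [← intervalIntegral.integral_eq_sub_of_hasDerivAt hderiv
    (ContinuousOn.intervalIntegrable_of_Icc hab (hcont.mono hsub))]
  refine (sq_intervalIntegral_le hab (hcont.mono hsub)).trans ?_
  refine mul_le_mul_of_nonneg_left ?_ (sub_nonneg.2 hab)
  rw [intervalIntegral.integral_of_le hab]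
  exact setIntegral_mono_set ((hcont.pow 2).integrableOn_Icc)
    (Filter.Eventually.of_forall fun _ => sq_nonneg _)
    (Set.Ioc_subset_Icc_self.trans hsub).eventuallyLE

/-- Error bound for a difference `u - v` that is small at two points around `x`. -/
lemma sq_sub_le_of_sq_endpoints_le {u v : ℝ → ℝ} {l r a b x ε M : ℝ}
    (hu : ContDiffOn ℝ 2 u (Set.Icc l r)) (hv : ContDiffOn ℝ 2 v (Set.Icc l r))
    (hla : l ≤ a) (hax : a < x) (hxb : x < b) (hbr : b ≤ r)
    (huM : ∫ t in Set.Icc l r, (iteratedDerivWithin 2 u (Set.Icc l r) t) ^ 2 ≤ M)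
    (hvM : ∫ t in Set.Icc l r, (iteratedDerivWithin 2 v (Set.Icc l r) t) ^ 2 ≤ M)
    (ha : (u a - v a) ^ 2 ≤ ε) (hb : (u b - v b) ^ 2 ≤ ε) :
    (u x - v x) ^ 2 ≤ 2 * ε + 8 * M * (b - a) ^ 3 := by
  have hderiv : ∀ t ∈ Set.Ioo l r, HasDerivAt (fun s => u s - v s)
      (derivWithin u (Set.Icc l r) t - derivWithin v (Set.Icc l r) t) t := by
    intro t ht
    have ht' : t ∈ Set.Icc l r := ⟨ht.1.le, ht.2.le⟩
    have hn := Icc_mem_nhds ht.1 ht.2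
    exact (((hu.differentiableOn (by norm_num)) t ht').hasDerivWithinAt.hasDerivAt hn).sub
      (((hv.differentiableOn (by norm_num)) t ht').hasDerivWithinAt.hasDerivAt hn)
  have hcont : ContinuousOn (fun s => u s - v s) (Set.Icc l r) :=
    hu.continuousOn.sub hv.continuousOn
  obtain ⟨ξ, hξ, hξe⟩ := exists_hasDerivAt_eq_slope (fun s => u s - v s) _ hax
    (hcont.mono (Set.Icc_subset_Icc hla (hxb.le.trans hbr)))
    (fun t ht => hderiv t ⟨hla.trans_lt ht.1, ht.2.trans (hxb.trans_le hbr)⟩)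
  obtain ⟨η, hη, hηe⟩ := exists_hasDerivAt_eq_slope (fun s => u s - v s) _ hxb
    (hcont.mono (Set.Icc_subset_Icc (hla.trans hax.le) hbr))
    (fun t ht => hderiv t ⟨(hla.trans_lt hax).trans ht.1, ht.2.trans_le hbr⟩)
  have hξη : ξ ≤ η := (hξ.2.trans hη.1).le
  have hlξ : l < ξ := hla.trans_lt hξ.1
  have hηr : η < r := hη.2.trans_le hbr
  have hM : 0 ≤ M := le_trans (integral_nonneg fun _ => sq_nonneg _) huM
  have key : ∀ {w : ℝ → ℝ}, ContDiffOn ℝ 2 w (Set.Icc l r) →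
      ∫ t in Set.Icc l r, (iteratedDerivWithin 2 w (Set.Icc l r) t) ^ 2 ≤ M →
      (derivWithin w (Set.Icc l r) η - derivWithin w (Set.Icc l r) ξ) ^ 2 ≤ (b - a) * M := by
    intro w hw hwM
    refine (sq_derivWithin_sub_le hw hlξ hξη hηr).trans ?_
    exact mul_le_mul (by linarith [hξ.1, hη.2]) hwM (integral_nonneg fun _ => sq_nonneg _)
      (by linarith)
  have hU := key hu huM
  have hV := key hv hvM
  set du := derivWithin u (Set.Icc l r)
  set dv := derivWithin v (Set.Icc l r)
  have hh : 0 < b - a := by linarith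
  set D := (du ξ - dv ξ) - (du η - dv η) with hD
  have hD2 : D ^ 2 ≤ 4 * M * (b - a) := by
    have : D = (dv η - dv ξ) - (du η - du ξ) := by rw [hD]; ring
    rw [this]
    nlinarith [sq_nonneg ((dv η - dv ξ) + (du η - du ξ))]
  set s := (x - a) / (b - a) with hs
  have hs0 : 0 ≤ s := div_nonneg (by linarith) hh.le
  have hs1 : s ≤ 1 := (div_le_one hh).2 (by linarith)
  have hxs : x - a = s * (b - a) := by rw [hs]; field_simp
  have hbx : b - x = (1 - s) * (b - a) := by linarith
  rw [eq_div_iff (by linarith)] at hξe hηe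
  have hrep : u x - v x =
      ((1 - s) * (u a - v a) + s * (u b - v b)) + s * (1 - s) * (b - a) * D := by
    rw [hxs] at hξe
    rw [hbx] at hηe
    rw [hD]
    linear_combination (s - 1) * hξe + s * hηe
  have hL : ((1 - s) * (u a - v a) + s * (u b - v b)) ^ 2 ≤ ε := by
    calc ((1 - s) * (u a - v a) + s * (u b - v b)) ^ 2
        = (1 - s) * (u a - v a) ^ 2 + s * (u b - v b) ^ 2
            - s * (1 - s) * ((u a - v a) - (u b - v b)) ^ 2 := by ring
      _ ≤ (1 - s) * (u a - v a) ^ 2 + s * (u b - v b) ^ 2 := sub_le_self _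
          (mul_nonneg (mul_nonneg hs0 (sub_nonneg.2 hs1)) (sq_nonneg _))
      _ ≤ (1 - s) * ε + s * ε := add_le_add (mul_le_mul_of_nonneg_left ha (sub_nonneg.2 hs1))
          (mul_le_mul_of_nonneg_left hb hs0)
      _ = ε := by ring
  have hE : (s * (1 - s) * (b - a) * D) ^ 2 ≤ 4 * M * (b - a) ^ 3 := by
    have h1 : (s * (1 - s)) ^ 2 ≤ 1 :=
      pow_le_one₀ (mul_nonneg hs0 (sub_nonneg.2 hs1))
        (mul_le_one₀ hs1 (sub_nonneg.2 hs1) (by linarith))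
    calc (s * (1 - s) * (b - a) * D) ^ 2 = (s * (1 - s)) ^ 2 * ((b - a) ^ 2 * D ^ 2) := by ring
      _ ≤ 1 * ((b - a) ^ 2 * (4 * M * (b - a))) := by gcongr
      _ = _ := by ring
  rw [hrep]
  refine add_sq_le.trans ?_
  linarith

lemma SplineAdmissible.of_contDiffOn {g : ℝ → ℝ} (hg : ContDiffOn ℝ 2 g (Set.Icc (-1 : ℝ) 1)) :
    SplineAdmissible g :=
  ⟨hg, ((hg.continuousOn_iteratedDerivWithin le_rfl
    (uniqueDiffOn_Icc (by norm_num))).pow 2).integrableOn_Icc⟩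

lemma IsSmoothingSpline.splineLoss_le {N : ℕ} {F : Finset (Fin N)} {β : Fin N → ℝ} {lam : ℝ}
    {g u : ℝ → ℝ} (hg : ContDiffOn ℝ 2 g (Set.Icc (-1 : ℝ) 1))
    (hu : IsSmoothingSpline F β (fun v => g (β v)) lam u) :
    splineLoss F β (fun v => g (β v)) lam u ≤
      lam * ∫ t in Set.Icc (-1 : ℝ) 1, (iteratedDerivWithin 2 g (Set.Icc (-1 : ℝ) 1) t) ^ 2 := by
  simpa [splineLoss] using hu.2 g (.of_contDiffOn hg)

lemma IsSmoothingSpline.integral_sq_le {N : ℕ} {F : Finset (Fin N)} {β : Fin N → ℝ} {lam : ℝ}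
    {g u : ℝ → ℝ} (hg : ContDiffOn ℝ 2 g (Set.Icc (-1 : ℝ) 1)) (hlam : 0 < lam)
    (hu : IsSmoothingSpline F β (fun v => g (β v)) lam u) :
    ∫ t in Set.Icc (-1 : ℝ) 1, (iteratedDerivWithin 2 u (Set.Icc (-1 : ℝ) 1) t) ^ 2 ≤
      ∫ t in Set.Icc (-1 : ℝ) 1, (iteratedDerivWithin 2 g (Set.Icc (-1 : ℝ) 1) t) ^ 2 := by
  have h := hu.splineLoss_le hg
  refine le_of_mul_le_mul_left (le_trans ?_ h) hlam
  rw [splineLoss]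
  exact le_add_of_nonneg_left (by positivity)

lemma IsSmoothingSpline.sq_sub_le {N : ℕ} {F : Finset (Fin N)} {β : Fin N → ℝ} {lam : ℝ}
    {g u : ℝ → ℝ} (hg : ContDiffOn ℝ 2 g (Set.Icc (-1 : ℝ) 1)) (hlam : 0 < lam)
    (hu : IsSmoothingSpline F β (fun v => g (β v)) lam u) {v : Fin N} (hv : v ∈ F) :
    (u (β v) - g (β v)) ^ 2 ≤ N * (lam *
      ∫ t in Set.Icc (-1 : ℝ) 1, (iteratedDerivWithin 2 g (Set.Icc (-1 : ℝ) 1) t) ^ 2) := by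
  have h := hu.splineLoss_le hg
  have hG : 0 ≤ ∫ t in Set.Icc (-1 : ℝ) 1,
      (iteratedDerivWithin 2 g (Set.Icc (-1 : ℝ) 1) t) ^ 2 :=
    integral_nonneg fun _ => sq_nonneg _
  have hU : 0 ≤ ∫ t in Set.Icc (-1 : ℝ) 1,
      (iteratedDerivWithin 2 u (Set.Icc (-1 : ℝ) 1) t) ^ 2 :=
    integral_nonneg fun _ => sq_nonneg _
  have hcard : (0 : ℝ) < F.card := by exact_mod_cast Finset.card_pos.2 ⟨v, hv⟩
  have hcardN : (F.card : ℝ) ≤ N := by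
    exact_mod_cast (Finset.card_le_univ F).trans_eq (Fintype.card_fin N)
  rw [splineLoss] at h
  have h1 := (le_add_of_nonneg_right (mul_nonneg hlam.le hU)).trans h
  rw [one_div, inv_mul_le_iff₀ hcard] at h1
  refine (Finset.single_le_sum (f := fun v => (u (β v) - g (β v)) ^ 2)
    (fun _ _ => sq_nonneg _) hv).trans (h1.trans ?_)
  gcongr

lemma IsSmoothingSpline.sq_sub_le_of_between {N : ℕ} {F : Finset (Fin N)} {β : Fin N → ℝ}
    {lam x : ℝ} {g u : ℝ → ℝ} (hg : ContDiffOn ℝ 2 g (Set.Icc (-1 : ℝ) 1)) (hlam : 0 < lam)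
    (hu : IsSmoothingSpline F β (fun v => g (β v)) lam u) {a b : Fin N} (ha : a ∈ F) (hb : b ∈ F)
    (ha1 : -1 ≤ β a) (hax : β a < x) (hxb : x < β b) (hb1 : β b ≤ 1) :
    (u x - g x) ^ 2 ≤ (2 * (N * lam) + 8 * (β b - β a) ^ 3) *
      ∫ t in Set.Icc (-1 : ℝ) 1, (iteratedDerivWithin 2 g (Set.Icc (-1 : ℝ) 1) t) ^ 2 := by
  refine (sq_sub_le_of_sq_endpoints_le hu.1.1 hg ha1 hax hxb hb1 (hu.integral_sq_le hg hlam) le_rfl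
    (hu.sq_sub_le hg hlam ha) (hu.sq_sub_le hg hlam hb)).trans_eq ?_
  ring

lemma isProbabilityMeasure_bernoulliMeasure {p : ℝ} (hp : p ∈ Set.Icc (0 : ℝ) 1) :
    IsProbabilityMeasure (bernoulliMeasure p) := by
  constructor
  simp [bernoulliMeasure, ← ENNReal.ofReal_add hp.1 (sub_nonneg.2 hp.2)]

lemma isProbabilityMeasure_stragglerMeasure {p : ℝ} (hp : p ∈ Set.Icc (0 : ℝ) 1) (N : ℕ) :
    IsProbabilityMeasure (stragglerMeasure p N) := by
  have := isProbabilityMeasure_bernoulliMeasure hp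
  unfold stragglerMeasure
  infer_instance

lemma stragglerMeasure_forall_eq_true {p : ℝ} (hp : p ∈ Set.Icc (0 : ℝ) 1) {N : ℕ}
    (S : Finset (Fin N)) :
    stragglerMeasure p N {ω | ∀ i ∈ S, ω i = true} = ENNReal.ofReal (p ^ S.card) := by
  have := isProbabilityMeasure_bernoulliMeasure hp
  have hset : {ω : Fin N → Bool | ∀ i ∈ S, ω i = true} =
      Set.univ.pi fun i => if i ∈ S then {true} else Set.univ := by
    ext ω
    simp only [Set.mem_ofPred_eq, Set.mem_univ_pi]
    refine forall_congr' fun i => ?_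
    split_ifs with h <;> simp [h]
  have htrue : bernoulliMeasure p {true} = ENNReal.ofReal p := by
    simp [bernoulliMeasure]
  rw [hset, stragglerMeasure, Measure.pi_pi]
  calc ∏ i, bernoulliMeasure p (if i ∈ S then {true} else Set.univ)
      = ∏ i, if i ∈ S then ENNReal.ofReal p else 1 := by
        refine Finset.prod_congr rfl fun i _ => ?_
        split_ifs
        · exact htrue
        · exact measure_univ
    _ = ENNReal.ofReal (p ^ S.card) := by
        rw [Finset.prod_ite_mem, Finset.univ_inter, Finset.prod_const,
          ENNReal.ofReal_pow hp.1]

/-- Union bound: with the stated probability every block contains a non-straggler. -/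
lemma ofReal_le_stragglerMeasure_of_blocks {p δ : ℝ} (hp : p ∈ Set.Icc (0 : ℝ) 1) {N m : ℕ}
    {ι : Type*} [Fintype ι] (S : ι → Finset (Fin N)) (hS : ∀ i, (S i).card = m)
    (hδ : Fintype.card ι * p ^ m ≤ δ) {A : Set (Fin N → Bool)}
    (hA : ∀ ω, (∀ i, ∃ n ∈ S i, n ∈ nonStragglers ω) → ω ∈ A) :
    ENNReal.ofReal (1 - δ) ≤ stragglerMeasure p N A := by
  have := isProbabilityMeasure_stragglerMeasure hp N
  set B : Set (Fin N → Bool) := ⋃ i, {ω | ∀ n ∈ S i, ω n = true} with hB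
  have hsub : Bᶜ ⊆ A := by
    intro ω hω
    refine hA ω fun i => ?_
    simp only [hB, Set.mem_compl_iff, Set.mem_iUnion, Set.mem_ofPred_eq, not_exists] at hω
    have := hω i
    push Not at this
    obtain ⟨n, hn, hn'⟩ := this
    exact ⟨n, hn, by simpa [nonStragglers] using hn'⟩
  have hBm : stragglerMeasure p N B ≤ ENNReal.ofReal δ := by
    refine (measure_iUnion_fintype_le _ _).trans ?_
    simp only [stragglerMeasure_forall_eq_true hp, hS]
    rw [Finset.sum_const, Finset.card_univ, nsmul_eq_mul, ← ENNReal.ofReal_natCast,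
      ← ENNReal.ofReal_mul (Nat.cast_nonneg _)]
    exact ENNReal.ofReal_le_ofReal hδ
  have hBmeas : MeasurableSet B := (Set.toFinite B).measurableSet
  calc ENNReal.ofReal (1 - δ) = 1 - ENNReal.ofReal δ := by
        rw [ENNReal.ofReal_sub _ (le_trans (mul_nonneg (Nat.cast_nonneg _) (pow_nonneg hp.1 _)) hδ),
          ENNReal.ofReal_one]
    _ ≤ 1 - stragglerMeasure p N B := tsub_le_tsub_left hBm _
    _ = stragglerMeasure p N Bᶜ := (prob_compl_eq_one_sub hBmeas).symm
    _ ≤ _ := measure_mono hsub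

/-- Blocks of `m` consecutive Chebyshev nodes immediately on either side of `x`. -/
lemma exists_chebNodes_blocks {x : ℝ} (hx : x ∈ Set.Ioo (-1 : ℝ) 1) {N m : ℕ} (hN : 2 ≤ N)
    (hm1 : (m : ℝ) ≤ Real.arccos x / Real.pi * (N - 1))
    (hm2 : (m : ℝ) ≤ (1 - Real.arccos x / Real.pi) * (N - 1)) :
    ∃ S T : Finset (Fin N), S.card = m ∧ T.card = m ∧
      (∀ a ∈ S, chebNodes N a < x ∧ x - chebNodes N a ≤ m * Real.pi / (N - 1)) ∧
      (∀ b ∈ T, x < chebNodes N b ∧ chebNodes N b - x ≤ m * Real.pi / (N - 1)) := by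
  have hN1 : (0 : ℝ) < (N : ℝ) - 1 := by
    have : (2 : ℝ) ≤ N := by exact_mod_cast hN
    linarith
  set θ := Real.arccos x with hθ
  have hcos : Real.cos θ = x := Real.cos_arccos hx.1.le hx.2.le
  have hθ0 : 0 ≤ θ := Real.arccos_nonneg x
  have hθπ : θ ≤ Real.pi := Real.arccos_le_pi x
  have hπ := Real.pi_pos
  set t := θ / Real.pi * ((N : ℝ) - 1) with ht
  have htθ : t * Real.pi / ((N : ℝ) - 1) = θ := by rw [ht]; field_simp
  have ht0 : 0 ≤ t := by positivity
  have htm : t + m ≤ N - 1 := by linarith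
  have hlip : ∀ n : Fin N, |chebNodes N n - x| ≤ |(n : ℝ) - t| * Real.pi / (N - 1) := by
    intro n
    have h := Real.abs_cos_sub_cos_le ((n : ℕ) * Real.pi / ((N : ℝ) - 1)) θ
    rw [hcos] at h
    refine h.trans_eq ?_
    conv_lhs => rw [← htθ]
    rw [← sub_div, ← sub_mul, abs_div, abs_mul, abs_of_pos hπ, abs_of_pos hN1]
  have hbound : ∀ n : Fin N, |(n : ℝ) - t| ≤ m → |chebNodes N n - x| ≤ m * Real.pi / (N - 1) :=
    fun n hn => (hlip n).trans (by gcongr)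
  have hnode : ∀ n : Fin N, 0 ≤ (n : ℕ) * Real.pi / ((N : ℝ) - 1) ∧
      (n : ℕ) * Real.pi / ((N : ℝ) - 1) ≤ Real.pi := by
    intro n
    refine ⟨by positivity, ?_⟩
    rw [div_le_iff₀ hN1, mul_comm]
    have : (n : ℝ) + 1 ≤ N := by exact_mod_cast n.2
    exact mul_le_mul_of_nonneg_left (by linarith) hπ.le
  have hfl := Nat.floor_le ht0
  have hfl' := Nat.lt_floor_add_one t
  have hce := Nat.le_ceil t
  have hce' := Nat.ceil_lt_add_one ht0
  have hmc : m ≤ ⌈t⌉₊ := by exact_mod_cast hm1.trans hce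
  have hfm : ⌊t⌋₊ + m + 1 ≤ N := by
    have : (⌊t⌋₊ : ℝ) + m + 1 ≤ N := by linarith
    exact_mod_cast this
  have hcN : ⌈t⌉₊ ≤ N := by
    have : (⌈t⌉₊ : ℝ) ≤ N := by linarith [(Nat.cast_nonneg m : (0 : ℝ) ≤ m)]
    exact_mod_cast this
  refine ⟨Finset.attachFin (Finset.Ioc ⌊t⌋₊ (⌊t⌋₊ + m)) fun n hn => ?_,
    Finset.attachFin (Finset.Ico (⌈t⌉₊ - m) ⌈t⌉₊) fun n hn => ?_, ?_, ?_, fun n hn => ?_,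
    fun n hn => ?_⟩
  · rw [Finset.mem_Ioc] at hn; omega
  · rw [Finset.mem_Ico] at hn; omega
  · simp
  · simp [Nat.sub_sub_self hmc]
  · rw [Finset.mem_attachFin, Finset.mem_Ioc] at hn
    have hn1 : (⌊t⌋₊ : ℝ) + 1 ≤ (n : ℕ) := by exact_mod_cast hn.1
    have hn2 : ((n : ℕ) : ℝ) ≤ ⌊t⌋₊ + m := by exact_mod_cast hn.2
    have htn : t < (n : ℕ) := by linarith
    constructor
    · rw [← hcos, chebNodes]
      refine Real.cos_lt_cos_of_nonneg_of_le_pi hθ0 (hnode n).2 ?_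
      rw [← htθ]
      gcongr
    · have := hbound n (by rw [abs_of_pos (by linarith)]; linarith)
      linarith [neg_abs_le (chebNodes N n - x)]
  · rw [Finset.mem_attachFin, Finset.mem_Ico] at hn
    have hn1 : ((⌈t⌉₊ : ℝ) - m) ≤ (n : ℕ) := by
      rw [← Nat.cast_sub hmc]; exact_mod_cast hn.1
    have hn2 : ((n : ℕ) : ℝ) + 1 ≤ ⌈t⌉₊ := by exact_mod_cast hn.2
    have htn : ((n : ℕ) : ℝ) < t := by linarith
    constructor
    · rw [← hcos, chebNodes]
      refine Real.cos_lt_cos_of_nonneg_of_le_pi (hnode n).1 hθπ ?_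
      rw [← htθ]
      gcongr
    · have := hbound n (by rw [abs_of_neg (by linarith)]; linarith)
      linarith [le_abs_self (chebNodes N n - x)]

lemma eventually_logb_le_mul_sub_one {b c : ℝ} (hc : 0 < c) :
    ∀ᶠ N : ℕ in Filter.atTop, 2 * Real.logb b N ≤ c * ((N : ℝ) - 1) := by
  have h1 : Filter.Tendsto (fun x : ℝ => Real.log x / x) Filter.atTop (nhds 0) := by
    simpa using Real.tendsto_pow_log_div_mul_add_atTop 1 0 1 one_ne_zero
  have h2 : Filter.Tendsto (fun N : ℕ => 2 / Real.log b * (Real.log N / N) + c * (N : ℝ)⁻¹)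
      Filter.atTop (nhds 0) := by
    simpa using ((h1.comp tendsto_natCast_atTop_atTop).const_mul (2 / Real.log b)).add
      ((tendsto_inv_atTop_nhds_zero_nat (𝕜 := ℝ)).const_mul c)
  filter_upwards [h2.eventually_lt_const hc, Filter.eventually_gt_atTop 0] with N hN hN0
  have hNpos : (0 : ℝ) < N := by exact_mod_cast hN0
  have := mul_le_mul_of_nonneg_right hN.le hNpos.le
  have heq : (2 / Real.log b * (Real.log N / N) + c * (N : ℝ)⁻¹) * N =
      2 * Real.logb b N + c := by
    rw [Real.logb]; field_simp
  linarith

/-- **Corollary 2, LeTCC part:** with second-kind Chebyshev decoder points and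
`λ ≤ N^{−6}`, the `LeTCC` error still converges at rate `O(log³_{1/p}(N)·N^{−3})`
with high probability. -/
theorem letcc_chebyshev_rate_probabilistic_stragglers
    (p : ℝ) (hp : p ∈ Set.Ioo (0 : ℝ) 1) (δ : ℝ) (hδ : δ ∈ Set.Ioo (0 : ℝ) 1)
    (g : ℝ → ℝ) (hg : ContDiffOn ℝ 2 g (Set.Icc (-1 : ℝ) 1))
    (K : ℕ) (hK : 0 < K)
    (α : Fin K → ℝ) (hα : StrictMono α) (hα1 : ∀ k, α k ∈ Set.Ioo (-1 : ℝ) 1) :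
    ∃ C : ℝ, 0 < C ∧ ∃ n0 : ℕ, ∀ N : ℕ, 3 ≤ N → n0 < N →
      ∀ lam : ℝ, 0 < lam → lam ≤ ((N : ℝ) ^ 6)⁻¹ →
      ∀ udec : (Fin N → Bool) → ℝ → ℝ,
        (∀ ω, (nonStragglers ω).Nonempty →
          IsSmoothingSpline (nonStragglers ω) (chebNodes N)
            (fun v => g (chebNodes N v)) lam (udec ω)) →
      stragglerMeasure p N
        {ω | (nonStragglers ω).Nonempty ∧
          (1 / (K : ℝ)) * ∑ k, (udec ω (α k) - g (α k)) ^ 2 ≤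
            C * (Real.logb (1 / p) N) ^ 3 / (N : ℝ) ^ 3} ≥
        ENNReal.ofReal (1 - δ) := by
  have hp' : p ∈ Set.Icc (0 : ℝ) 1 := ⟨hp.1.le, hp.2.le⟩
  have hb : 1 < 1 / p := (one_lt_div hp.1).2 hp.2
  set G := ∫ t in Set.Icc (-1 : ℝ) 1, (iteratedDerivWithin 2 g (Set.Icc (-1 : ℝ) 1) t) ^ 2
    with hGdef
  have hG : 0 ≤ G := integral_nonneg fun _ => sq_nonneg _
  have hev : ∀ᶠ N : ℕ in Filter.atTop, 1 / p ≤ N ∧ 2 * K / δ ≤ N ∧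
      ∀ k, 2 * Real.logb (1 / p) N ≤ Real.arccos (α k) / Real.pi * (N - 1) ∧
        2 * Real.logb (1 / p) N ≤ (1 - Real.arccos (α k) / Real.pi) * (N - 1) := by
    refine (tendsto_natCast_atTop_atTop.eventually_ge_atTop _).and
      ((tendsto_natCast_atTop_atTop.eventually_ge_atTop _).and
        (Filter.eventually_all.2 fun k => ?_))
    have h0 : 0 < Real.arccos (α k) := Real.arccos_pos.2 (hα1 k).2
    have h1 : Real.arccos (α k) < Real.pi :=
      (Real.arccos_le_pi _).lt_of_ne fun h => (hα1 k).1.not_ge (Real.arccos_eq_pi.1 h)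
    exact (eventually_logb_le_mul_sub_one (div_pos h0 Real.pi_pos)).and
      (eventually_logb_le_mul_sub_one (sub_pos.2 ((div_lt_one Real.pi_pos).2 h1)))
  obtain ⟨n0, hn0⟩ := Filter.eventually_atTop.1 hev
  refine ⟨(2 + 8 * 32 ^ 3) * G + 1, by positivity, n0, fun N hN3 hnN lam hlam hlamN udec hudec => ?_⟩
  obtain ⟨hNp, hNδ, hNα⟩ := hn0 N hnN.le
  have hN : (3 : ℝ) ≤ N := by exact_mod_cast hN3
  have hN0 : (0 : ℝ) < N := by linarith
  set L := Real.logb (1 / p) N with hL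
  have hL1 : 1 ≤ L := by
    rw [hL, Real.le_logb_iff_rpow_le hb hN0, Real.rpow_one]
    exact hNp
  set m := ⌈L⌉₊
  have hLm : L ≤ m := Nat.le_ceil L
  have hmL : (m : ℝ) ≤ 2 * L := by linarith [Nat.ceil_lt_add_one (zero_le_one.trans hL1)]
  have hpm : p ^ m ≤ (N : ℝ)⁻¹ := by
    rw [← Real.rpow_natCast]
    refine (Real.rpow_le_rpow_of_exponent_ge hp.1 hp.2.le hLm).trans_eq ?_
    rw [← Real.rpow_logb (by positivity) hb.ne' hN0, ← hL, one_div, Real.inv_rpow hp.1.le, inv_inv]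
  choose S T hS hT hSx hTx using fun k => exists_chebNodes_blocks (hα1 k) (by omega)
    (hmL.trans (hNα k).1) (hmL.trans (hNα k).2)
  refine ofReal_le_stragglerMeasure_of_blocks hp' (fun i : Fin K ⊕ Fin K => Sum.elim S T i)
    (m := m) ?_ ?_ fun ω hω => ?_
  · rintro (k | k)
    exacts [hS k, hT k]
  · rw [Fintype.card_sum, Fintype.card_fin]
    refine (mul_le_mul_of_nonneg_left hpm (Nat.cast_nonneg _)).trans ?_
    rw [div_le_iff₀ hδ.1] at hNδ
    rw [← div_eq_mul_inv, div_le_iff₀ hN0]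
    push_cast
    linarith
  have hne : (nonStragglers ω).Nonempty := by
    obtain ⟨n, -, hn⟩ := hω (Sum.inl ⟨0, hK⟩)
    exact ⟨n, hn⟩
  refine ⟨hne, ?_⟩
  have hterm : ∀ k, (udec ω (α k) - g (α k)) ^ 2 ≤
      ((2 + 8 * 32 ^ 3) * G + 1) * L ^ 3 / (N : ℝ) ^ 3 := by
    intro k
    obtain ⟨a, haS, ha⟩ := hω (Sum.inl k)
    obtain ⟨b, hbT, hb'⟩ := hω (Sum.inr k)
    obtain ⟨hax, had⟩ := hSx k a haS
    obtain ⟨hxb, hbd⟩ := hTx k b hbT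
    have hbound := (hudec ω hne).sq_sub_le_of_between hg hlam ha hb' (Real.neg_one_le_cos _)
      hax hxb (Real.cos_le_one _)
    have hblock : m * Real.pi / ((N : ℝ) - 1) ≤ 16 * (L / N) := by
      rw [← mul_div_assoc, div_le_div_iff₀ (by linarith) hN0]
      calc m * Real.pi * N ≤ (2 * L) * 4 * N := by gcongr; exact Real.pi_le_four
        _ ≤ 16 * L * (N - 1) := by nlinarith
    have hgap : (chebNodes N b - chebNodes N a) ^ 3 ≤ (32 * (L / N)) ^ 3 :=
      pow_le_pow_left₀ (by linarith) (by linarith) 3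
    have hNlam : N * lam ≤ (L / N) ^ 3 := by
      have h1 : (1 : ℝ) ≤ N := by linarith
      calc N * lam ≤ N * ((N : ℝ) ^ 6)⁻¹ := by gcongr
        _ = 1 / (N : ℝ) ^ 5 := by field_simp
        _ ≤ L ^ 3 / (N : ℝ) ^ 3 := by
          gcongr
          · exact one_le_pow₀ hL1
          · norm_num
        _ = _ := (div_pow _ _ _).symm
    calc (udec ω (α k) - g (α k)) ^ 2
        ≤ (2 * (N * lam) + 8 * (chebNodes N b - chebNodes N a) ^ 3) * G := hbound
      _ ≤ (2 * (L / N) ^ 3 + 8 * (32 * (L / N)) ^ 3) * G := by gcongr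
      _ = ((2 + 8 * 32 ^ 3) * G) * (L / N) ^ 3 := by ring
      _ ≤ ((2 + 8 * 32 ^ 3) * G + 1) * (L / N) ^ 3 := by gcongr; linarith
      _ = _ := by rw [div_pow, mul_div_assoc]
  have hK0 : (0 : ℝ) < K := by exact_mod_cast hK
  rw [one_div, inv_mul_le_iff₀ hK0]
  refine (Finset.sum_le_sum fun k _ => hterm k).trans_eq ?_
  rw [Finset.sum_const, Finset.card_univ, Fintype.card_fin, nsmul_eq_mul]
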